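/- arXiv:1801.02795 — 5 statements merged into one kernel-verified Lean document; each statement's English description precedes it below -/
import Mathlib

section
/- If a₁, a₂, a₃, a₄ are nonnegative real numbers, then Q(a₁N₁ + a₂N₂, a₃N₁ + a₄N₂) ≥ 0. -/
open Matrix

/-- The "lower-index" metric matrix g = (g_{ij}) in Bondi–Sachs-type coordinates. -/
noncomputable def gLow (z V U2 U3 : ℝ) (h : Matrix (Fin 2) (Fin 2) ℝ) :
    Matrix (Fin 4) (Fin 4) ℝ :=
  !![-z ^ 2 * V + (h 0 0 * U2 * U2 + h 0 1 * U2 * U3 + h 1 0 * U3 * U2 + h 1 1 * U3 * U3), 1,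
        -(h 0 0 * U2 + h 0 1 * U3), -(h 1 0 * U2 + h 1 1 * U3);
      1, 0, 0, 0;
      -(h 0 0 * U2 + h 0 1 * U3), 0, h 0 0, h 0 1;
      -(h 1 0 * U2 + h 1 1 * U3), 0, h 1 0, h 1 1]

/-- The "upper-index" matrix ḡ = (g^{ij}), where k = (h^{AB}) is the inverse of (h_{AB}). -/
noncomputable def gUp (z V U2 U3 : ℝ) (k : Matrix (Fin 2) (Fin 2) ℝ) :
    Matrix (Fin 4) (Fin 4) ℝ :=
  !![0, 1, 0, 0;
      1, z ^ 2 * V, U2, U3;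
      0, U2, k 0 0, k 0 1;
      0, U3, k 1 0, k 1 1]

/-- The null vector N₁ = (0, −1, 0, 0). -/
noncomputable def N1 : Fin 4 → ℝ := ![0, -1, 0, 0]

/-- The null vector N₂ = (1, ½ z²V, U², U³). -/
noncomputable def N2 (z V U2 U3 : ℝ) : Fin 4 → ℝ := ![1, 1 / 2 * z ^ 2 * V, U2, U3]

/-- The gradient vector ∇τ = (0, 1, 0, 0). -/
noncomputable def gradTau : Fin 4 → ℝ := ![0, 1, 0, 0]

/-- The gradient vector ∇z = (1, z²V, U², U³). -/
noncomputable def gradZ (z V U2 U3 : ℝ) : Fin 4 → ℝ := ![1, z ^ 2 * V, U2, U3]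

/-- The energy–momentum form
`Q(X,Y) = (Σ p_i X^i)(Σ p_j Y^j) − ½ (Xᵀ g Y)(pᵀ ḡ p) − (Xᵀ g Y) c²`. -/
noncomputable def Qf (z V U2 U3 : ℝ) (h k : Matrix (Fin 2) (Fin 2) ℝ)
    (p : Fin 4 → ℝ) (c : ℝ) (X Y : Fin 4 → ℝ) : ℝ :=
  (p ⬝ᵥ X) * (p ⬝ᵥ Y)
    - 1 / 2 * (X ⬝ᵥ (gLow z V U2 U3 h).mulVec Y) * (p ⬝ᵥ (gUp z V U2 U3 k).mulVec p)
    - (X ⬝ᵥ (gLow z V U2 U3 h).mulVec Y) * c ^ 2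

/-- On nonnegative combinations of the null vectors `N1` and `N2` the energy–momentum form is a
combination of squares and the angular gradient term. -/
lemma Qf_N1_N2 (z V U2 U3 : ℝ) (h k : Matrix (Fin 2) (Fin 2) ℝ) (hsymm : h.IsSymm)
    (p : Fin 4 → ℝ) (c a1 a2 a3 a4 : ℝ) :
    Qf z V U2 U3 h k p c (a1 • N1 + a2 • N2 z V U2 U3) (a3 • N1 + a4 • N2 z V U2 U3) =
      a1 * a3 * p 1 ^ 2 + a2 * a4 * (p ⬝ᵥ N2 z V U2 U3) ^ 2
        + (a1 * a4 + a2 * a3) * (1 / 2 * (![p 2, p 3] ⬝ᵥ k.mulVec ![p 2, p 3]) + c ^ 2) := by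
  have h10 : h 1 0 = h 0 1 := hsymm.apply 0 1
  simp [Qf, gLow, gUp, N1, N2, dotProduct, mulVec, Fin.sum_univ_four, Fin.sum_univ_two, h10]
  ring

/-- if a₁, a₂, a₃, a₄ are nonnegative then
Q(a₁N₁ + a₂N₂, a₃N₁ + a₄N₂) ≥ 0. -/
theorem stmt_5 (z V U2 U3 : ℝ) (h k : Matrix (Fin 2) (Fin 2) ℝ)
    (hsymm : h.IsSymm) (hpd : h.PosDef) (hk : h * k = 1)
    (p : Fin 4 → ℝ) (c : ℝ)
    (a1 a2 a3 a4 : ℝ) (h1 : 0 ≤ a1) (h2 : 0 ≤ a2) (h3 : 0 ≤ a3) (h4 : 0 ≤ a4) :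
    0 ≤ Qf z V U2 U3 h k p c (a1 • N1 + a2 • N2 z V U2 U3)
          (a3 • N1 + a4 • N2 z V U2 U3) := by
  have hkpd : k.PosDef := by
    rw [← Matrix.inv_eq_right_inv hk]
    exact hpd.inv
  have hnn : 0 ≤ ![p 2, p 3] ⬝ᵥ k.mulVec ![p 2, p 3] := by
    simpa using hkpd.posSemidef.dotProduct_mulVec_nonneg ![p 2, p 3]
  rw [Qf_N1_N2 z V U2 U3 h k hsymm]
  positivity
end

section
/- For every m ∈ ℝ, setting Y = m·N₁ + N₂, one has Q(∇τ, Y) = −m p₁² − ½ Σ_{A,B} h^{AB} p_A p_B − c² and Q(∇z, Y) = (Σ_i p_i N₂^i)² + ½ m Σ_{A,B} h^{AB} p_A p_B + m c² − ½ z²V [ m p₁² + ½ Σ_{A,B} h^{AB} p_A p_B + c² ]. In particular, if m ≥ 0 then Q(∇τ, Y) ≤ 0. -/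
open Matrix

/-- The quadratic form of a right inverse of a positive definite 2×2 matrix is nonnegative. -/
theorem quadForm_nonneg_of_posDef_mul_eq_one {h k : Matrix (Fin 2) (Fin 2) ℝ}
    (hpd : h.PosDef) (hk : h * k = 1) (x y : ℝ) :
    0 ≤ k 0 0 * x * x + k 0 1 * x * y + k 1 0 * y * x + k 1 1 * y * y := by
  have hkpd : k.PosDef := Matrix.inv_eq_right_inv hk ▸ hpd.inv
  have hnonneg := hkpd.posSemidef.dotProduct_mulVec_nonneg ![x, y]
  simp [Matrix.mulVec, dotProduct, Fin.sum_univ_two] at hnonneg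
  linarith

/-- for Y = m·N₁ + N₂,
Q(∇τ, Y) = −m p₁² − ½ Σ h^{AB} p_A p_B − c² and
Q(∇z, Y) = (Σ p_i N₂^i)² + ½m Σ h^{AB} p_A p_B + m c²
  − ½ z²V [m p₁² + ½ Σ h^{AB} p_A p_B + c²];
in particular if m ≥ 0 then Q(∇τ, Y) ≤ 0. -/
theorem stmt_8 (z V U2 U3 : ℝ) (h k : Matrix (Fin 2) (Fin 2) ℝ)
    (hsymm : h.IsSymm) (hpd : h.PosDef) (hk : h * k = 1)
    (p : Fin 4 → ℝ) (c : ℝ) (m : ℝ) :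
    Qf z V U2 U3 h k p c gradTau (m • N1 + N2 z V U2 U3)
      = -m * (p 1) ^ 2
        - 1 / 2 * (k 0 0 * p 2 * p 2 + k 0 1 * p 2 * p 3
            + k 1 0 * p 3 * p 2 + k 1 1 * p 3 * p 3)
        - c ^ 2 ∧
    Qf z V U2 U3 h k p c (gradZ z V U2 U3) (m • N1 + N2 z V U2 U3)
      = (p ⬝ᵥ N2 z V U2 U3) ^ 2
        + 1 / 2 * m * (k 0 0 * p 2 * p 2 + k 0 1 * p 2 * p 3
            + k 1 0 * p 3 * p 2 + k 1 1 * p 3 * p 3)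
        + m * c ^ 2
        - 1 / 2 * z ^ 2 * V *
          (m * (p 1) ^ 2
            + 1 / 2 * (k 0 0 * p 2 * p 2 + k 0 1 * p 2 * p 3
                + k 1 0 * p 3 * p 2 + k 1 1 * p 3 * p 3)
            + c ^ 2) ∧
    (0 ≤ m → Qf z V U2 U3 h k p c gradTau (m • N1 + N2 z V U2 U3) ≤ 0) := by
  have hoff : h 1 0 = h 0 1 := hsymm.apply 0 1
  have hτ : Qf z V U2 U3 h k p c gradTau (m • N1 + N2 z V U2 U3)
      = -m * (p 1) ^ 2
        - 1 / 2 * (k 0 0 * p 2 * p 2 + k 0 1 * p 2 * p 3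
            + k 1 0 * p 3 * p 2 + k 1 1 * p 3 * p 3)
        - c ^ 2 := by
    simp [Qf, gLow, gUp, N1, N2, gradTau, Matrix.mulVec, dotProduct, Fin.sum_univ_four]
    ring
  refine ⟨hτ, ?_, fun hm => ?_⟩
  · simp [Qf, gLow, gUp, N1, N2, gradZ, Matrix.mulVec, dotProduct, Fin.sum_univ_four, hoff]
    ring
  · rw [hτ]
    linarith [quadForm_nonneg_of_posDef_mul_eq_one hpd hk (p 2) (p 3),
      mul_nonneg hm (sq_nonneg (p 1)), sq_nonneg c]
end

section
/- Let z₀ > 0, K ≥ 0, 0 < λ ≤ Λ, and m > 0. There exists a constant l₀ > 0, depending only on z₀, K, λ, Λ and m, with the following property: whenever 0 ≤ z ≤ z₀, ½ ≤ V ≤ 3/2, λ·I₂ ≤ (h_{AB}) ≤ Λ·I₂ (as quadratic forms), and |U²|, |U³| ≤ K, then for every l ≥ l₀, every q > 0, and all p ∈ ℝ⁴, c ∈ ℝ, the vector W = (lq − ½ q z²V)·N₁ + q·N₂ (which equals the gradient −lq·∇τ + q·∇z of the weight function w = −lq·τ + q·z) satisfies Q(W, m·N₁ + N₂) ≥ ½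 q ( p₀² + p₁² + Σ_{A,B} h^{AB} p_A p_B + c² ). -/
open Matrix

/-- If a symmetric form satisfies `0 ≤ h ≤ Λ`, then its inverse satisfies `I ≤ Λ h⁻¹`. -/
theorem dotProduct_self_le_mul_inverse_form {n : Type*} [Fintype n] [DecidableEq n]
    {h k : Matrix n n ℝ} (hsymm : h.IsSymm) (hk : h * k = 1) {Lam : ℝ} (hLam : 0 < Lam)
    (hnonneg : ∀ ξ : n → ℝ, 0 ≤ ξ ⬝ᵥ h.mulVec ξ)
    (hupper : ∀ ξ : n → ℝ, ξ ⬝ᵥ h.mulVec ξ ≤ Lam * (ξ ⬝ᵥ ξ)) (v : n → ℝ) :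
    v ⬝ᵥ v ≤ Lam * (v ⬝ᵥ k.mulVec v) := by
  have hinv : h.mulVec (k.mulVec v) = v := by rw [mulVec_mulVec, hk, one_mulVec]
  have hswap : k.mulVec v ⬝ᵥ h.mulVec v = v ⬝ᵥ v := by
    rw [dotProduct_mulVec, ← mulVec_transpose, hsymm.eq, hinv]
  have hpos := hnonneg (Lam • k.mulVec v - v)
  simp only [mulVec_sub, mulVec_smul, hinv, dotProduct_sub, sub_dotProduct, smul_dotProduct,
    dotProduct_smul, smul_eq_mul, hswap, dotProduct_comm (k.mulVec v) v] at hpos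
  have hmul : Lam * (v ⬝ᵥ v) ≤ Lam * (Lam * (v ⬝ᵥ k.mulVec v)) := by
    linarith [hupper v]
  exact le_of_mul_le_mul_left hmul hLam

/-- In the null frame `N₁`, `N₂` the energy–momentum form is diagonal up to the inverse
angular metric. -/
theorem Qf_null_frame (z V U2 U3 : ℝ) {h : Matrix (Fin 2) (Fin 2) ℝ} (hsymm : h.IsSymm)
    (k : Matrix (Fin 2) (Fin 2) ℝ) (p : Fin 4 → ℝ) (c α β m : ℝ) :
    Qf z V U2 U3 h k p c (α • N1 + β • N2 z V U2 U3) (m • N1 + N2 z V U2 U3) =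
      α * m * p 1 ^ 2 + β * (p 0 + 1 / 2 * z ^ 2 * V * p 1 + U2 * p 2 + U3 * p 3) ^ 2
        + (α + β * m) * (1 / 2 * (k 0 0 * p 2 * p 2 + k 0 1 * p 2 * p 3
            + k 1 0 * p 3 * p 2 + k 1 1 * p 3 * p 3) + c ^ 2) := by
  have h10 : h 1 0 = h 0 1 := hsymm.apply 0 1
  simp [Qf, gLow, gUp, N1, N2, dotProduct, mulVec, Fin.sum_univ_four, h10]
  ring

/-- given z₀ > 0, K ≥ 0, 0 < λ ≤ Λ, m > 0, there is l₀ > 0 (depending only on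
z₀, K, λ, Λ, m) such that whenever 0 ≤ z ≤ z₀, ½ ≤ V ≤ 3/2, λI₂ ≤ (h_{AB}) ≤ ΛI₂ and
|U²|, |U³| ≤ K, then for every l ≥ l₀, q > 0, p ∈ ℝ⁴, c ∈ ℝ, the vector
W = (lq − ½qz²V)·N₁ + q·N₂ (the gradient of w = −lq·τ + q·z) satisfies
Q(W, m·N₁ + N₂) ≥ ½ q (p₀² + p₁² + Σ h^{AB} p_A p_B + c²). -/
theorem stmt_10 (z₀ K lam Lam m : ℝ)
    (hz₀ : 0 < z₀) (hK : 0 ≤ K) (hlam : 0 < lam) (hlL : lam ≤ Lam) (hm : 0 < m) :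
    ∃ l₀ : ℝ, 0 < l₀ ∧
      ∀ (z V U2 U3 : ℝ) (h k : Matrix (Fin 2) (Fin 2) ℝ),
        h.IsSymm → h.PosDef → h * k = 1 →
        0 ≤ z → z ≤ z₀ → 1 / 2 ≤ V → V ≤ 3 / 2 →
        (∀ ξ : Fin 2 → ℝ, lam * (ξ ⬝ᵥ ξ) ≤ ξ ⬝ᵥ h.mulVec ξ
            ∧ ξ ⬝ᵥ h.mulVec ξ ≤ Lam * (ξ ⬝ᵥ ξ)) →
        |U2| ≤ K → |U3| ≤ K →
        ∀ l : ℝ, l₀ ≤ l → ∀ q : ℝ, 0 < q → ∀ (p : Fin 4 → ℝ) (c : ℝ),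
          Qf z V U2 U3 h k p c
              ((l * q - 1 / 2 * q * z ^ 2 * V) • N1 + q • N2 z V U2 U3)
              (m • N1 + N2 z V U2 U3)
            ≥ 1 / 2 * q * ((p 0) ^ 2 + (p 1) ^ 2
                + (k 0 0 * p 2 * p 2 + k 0 1 * p 2 * p 3
                    + k 1 0 * p 3 * p 2 + k 1 1 * p 3 * p 3)
                + c ^ 2) := by
  have hLam : 0 < Lam := hlam.trans_le hlL
  refine ⟨3 / 4 * z₀ ^ 2 + 1 + 8 * K ^ 2 * Lam + (1 / 2 + 9 / 8 * z₀ ^ 4) / m, by positivity, ?_⟩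
  intro z V U2 U3 h k hsymm hpd hhk hz hzz hV1 hV2 hbd hU2 hU3 l hl q hq p c
  rw [Qf_null_frame z V U2 U3 hsymm]
  have hinv := dotProduct_self_le_mul_inverse_form hsymm hhk hLam
    (fun ξ => (mul_nonneg hlam.le (by simpa using dotProduct_star_self_nonneg ξ)).trans (hbd ξ).1)
    (fun ξ => (hbd ξ).2) ![p 2, p 3]
  set S := k 0 0 * p 2 * p 2 + k 0 1 * p 2 * p 3 + k 1 0 * p 3 * p 2 + k 1 1 * p 3 * p 3 with hS
  have hpS : p 2 ^ 2 + p 3 ^ 2 ≤ Lam * S := by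
    simp [dotProduct, mulVec, Fin.sum_univ_two] at hinv
    rw [hS]
    linarith
  have hS0 : 0 ≤ S := nonneg_of_mul_nonneg_right ((by positivity : (0:ℝ) ≤ _).trans hpS) hLam
  set b := p 0 + 1 / 2 * z ^ 2 * V * p 1 + U2 * p 2 + U3 * p 3 with hb
  set s := 1 / 2 * z ^ 2 * V with hs
  have hs0 : 0 ≤ s := by positivity
  have hs1 : s ≤ 3 / 4 * z₀ ^ 2 := by
    have hzsq : z ^ 2 ≤ z₀ ^ 2 := by gcongr
    have := mul_le_mul hzsq hV2 (by linarith) (sq_nonneg z₀)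
    rw [hs]; linarith
  have hs2 : s ^ 2 ≤ 9 / 16 * z₀ ^ 4 := by
    calc s ^ 2 ≤ (3 / 4 * z₀ ^ 2) ^ 2 := by gcongr
      _ = _ := by ring
  have hU2sq : U2 ^ 2 ≤ K ^ 2 := sq_le_sq' (abs_le.mp hU2).1 (abs_le.mp hU2).2
  have hU3sq : U3 ^ 2 ≤ K ^ 2 := sq_le_sq' (abs_le.mp hU3).1 (abs_le.mp hU3).2
  have hUp : (U2 * p 2 + U3 * p 3) ^ 2 ≤ 2 * K ^ 2 * (Lam * S) := by
    have h2 := mul_le_mul_of_nonneg_right hU2sq (sq_nonneg (p 2))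
    have h3 := mul_le_mul_of_nonneg_right hU3sq (sq_nonneg (p 3))
    have hK2 := mul_le_mul_of_nonneg_left hpS (sq_nonneg K)
    linarith [sq_nonneg (U2 * p 2 - U3 * p 3)]
  have hp0 : p 0 ^ 2 ≤ 2 * b ^ 2 + 9 / 4 * z₀ ^ 4 * p 1 ^ 2 + 8 * K ^ 2 * Lam * S := by
    have h1 := mul_le_mul_of_nonneg_right hs2 (sq_nonneg (p 1))
    have hdecomp : p 0 = b - (s * p 1 + (U2 * p 2 + U3 * p 3)) := by rw [hb]; ring
    rw [hdecomp]
    linarith [sq_nonneg (b + (s * p 1 + (U2 * p 2 + U3 * p 3))),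
      sq_nonneg (s * p 1 - (U2 * p 2 + U3 * p 3))]
  have hquot : 0 ≤ (1 / 2 + 9 / 8 * z₀ ^ 4) / m := by positivity
  have hKL : 0 ≤ K ^ 2 * Lam := by positivity
  have hrad : 1 / 2 + 9 / 8 * z₀ ^ 4 ≤ (l - s) * m := by
    rw [← div_le_iff₀ hm]; linarith
  have hang : 1 + 8 * K ^ 2 * Lam ≤ l - s + m := by linarith
  have e1 := mul_le_mul_of_nonneg_right hrad (sq_nonneg (p 1))
  have e2 := mul_le_mul_of_nonneg_right hang hS0
  have e3 := mul_le_mul_of_nonneg_right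
    (show 1 / 2 ≤ l - s + m by linarith) (sq_nonneg c)
  have key : 1 / 2 * (p 0 ^ 2 + p 1 ^ 2 + S + c ^ 2) ≤
      (l - s) * m * p 1 ^ 2 + b ^ 2 + (l - s + m) * (1 / 2 * S + c ^ 2) := by
    linarith
  have hscaled := mul_le_mul_of_nonneg_left key hq.le
  have hcoef : l * q - 1 / 2 * q * z ^ 2 * V = q * (l - s) := by rw [hs]; ring
  rw [hcoef]
  linarith
end

section
/- Suppose z = z₀ > 0 and V ≥ ½, and set m = ¼ z₀². Then for all p ∈ ℝ⁴ and c ∈ ℝ, Q(∇z, m·N₁ + N₂) ≤ (Σ_i p_i N₂^i)² − ½ z₀² V m p₁². -/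
open Matrix

/-- Lowering the index of `∇z` gives `dz`. -/
lemma gradZ_dotProduct_gLow_mulVec (z V U2 U3 : ℝ) (h : Matrix (Fin 2) (Fin 2) ℝ)
    (hsymm : h.IsSymm) (Y : Fin 4 → ℝ) :
    gradZ z V U2 U3 ⬝ᵥ (gLow z V U2 U3 h).mulVec Y = Y 1 := by
  have h10 : h 1 0 = h 0 1 := hsymm.apply 0 1
  simp [gradZ, gLow, dotProduct, mulVec, Fin.sum_univ_four, h10]
  ring

/-- Null-frame decomposition of the inverse metric. -/
lemma dotProduct_gUp_mulVec (z V U2 U3 : ℝ) (k : Matrix (Fin 2) (Fin 2) ℝ) (p : Fin 4 → ℝ) :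
    p ⬝ᵥ (gUp z V U2 U3 k).mulVec p
      = 2 * p 1 * (p ⬝ᵥ N2 z V U2 U3) + ![p 2, p 3] ⬝ᵥ k.mulVec ![p 2, p 3] := by
  simp [gUp, N2, dotProduct, mulVec, Fin.sum_univ_four, Fin.sum_univ_two]
  ring

lemma dotProduct_gradZ (z V U2 U3 : ℝ) (p : Fin 4 → ℝ) :
    p ⬝ᵥ gradZ z V U2 U3 = p ⬝ᵥ N2 z V U2 U3 + 1 / 2 * z ^ 2 * V * p 1 := by
  simp [gradZ, N2, dotProduct, Fin.sum_univ_four]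
  ring

lemma dotProduct_smul_N1_add (m : ℝ) (p Y : Fin 4 → ℝ) :
    p ⬝ᵥ (m • N1 + Y) = p ⬝ᵥ Y - m * p 1 := by
  simp [N1, dotProduct, Fin.sum_univ_four]
  ring

/-- if z = z₀ > 0, V ≥ ½ and m = ¼ z₀², then for all p, c:
Q(∇z, m·N₁ + N₂) ≤ (Σ p_i N₂^i)² − ½ z₀² V m p₁². -/
theorem stmt_12 (z₀ V U2 U3 : ℝ) (hz₀ : 0 < z₀) (hV : 1 / 2 ≤ V)
    (h k : Matrix (Fin 2) (Fin 2) ℝ)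
    (hsymm : h.IsSymm) (hpd : h.PosDef) (hk : h * k = 1)
    (p : Fin 4 → ℝ) (c : ℝ) :
    Qf z₀ V U2 U3 h k p c (gradZ z₀ V U2 U3)
        ((1 / 4 * z₀ ^ 2) • N1 + N2 z₀ V U2 U3)
      ≤ (p ⬝ᵥ N2 z₀ V U2 U3) ^ 2
        - 1 / 2 * z₀ ^ 2 * V * (1 / 4 * z₀ ^ 2) * (p 1) ^ 2 := by
  have hK : 0 ≤ ![p 2, p 3] ⬝ᵥ k.mulVec ![p 2, p 3] := by
    rw [← Matrix.inv_eq_right_inv hk]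
    simpa using hpd.inv.posSemidef.dotProduct_mulVec_nonneg ![p 2, p 3]
  have hY : ((1 / 4 * z₀ ^ 2) • N1 + N2 z₀ V U2 U3) 1 = 1 / 2 * z₀ ^ 2 * (V - 1 / 2) := by
    simp [N1, N2]
    ring
  have hnonneg : 0 ≤ 1 / 2 * z₀ ^ 2 * (V - 1 / 2) :=
    mul_nonneg (by positivity) (sub_nonneg.mpr hV)
  rw [Qf, gradZ_dotProduct_gLow_mulVec z₀ V U2 U3 h hsymm, hY, dotProduct_gUp_mulVec,
    dotProduct_gradZ, dotProduct_smul_N1_add]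
  linarith [mul_nonneg hnonneg hK, mul_nonneg hnonneg (sq_nonneg c)]
end

section
/- With Q, π and P as defined, the following divergence identity holds at every point of U: μ⁻¹ Σ_{α=0}^{3} ∂_α(μ P^α) = (□_g φ)(Σ_γ X^γ ∂_γ φ) + ½ Σ_{α,β=0}^{3} Q_{αβ} π^{αβ} − 2 (Σ_γ X^γ ∂_γ φ) φ. -/
/-- The partial derivative ∂_i f(x) of a function f : ℝ⁴ → ℝ. -/
noncomputable def pd (i : Fin 4) (f : (Fin 4 → ℝ) → ℝ) (x : Fin 4 → ℝ) : ℝ :=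
  fderiv ℝ f x (Pi.single i 1)

open Finset

/-- **Jacobi's formula** for the derivative of a determinant. -/
theorem hasFDerivAt_det {E n : Type*} [NormedAddCommGroup E] [NormedSpace ℝ E] [Fintype n]
    [DecidableEq n] {A : E → Matrix n n ℝ} {A' : n → n → E →L[ℝ] ℝ} {x : E}
    (hA : ∀ i j, HasFDerivAt (fun y => A y i j) (A' i j) x) :
    HasFDerivAt (fun y => (A y).det) (∑ i, ∑ k, (A x).adjugate i k • A' k i) x := by
  have h : HasFDerivAt (fun y => ∑ σ : Equiv.Perm n, ((σ.sign : ℤ) : ℝ) * ∏ i, A y (σ i) i)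
      (∑ σ : Equiv.Perm n, ((σ.sign : ℤ) : ℝ) •
        ∑ i, (∏ j ∈ univ.erase i, A x (σ j) j) • A' (σ i) i) x :=
    HasFDerivAt.fun_sum fun σ _ =>
      (HasFDerivAt.finsetProd fun i _ => hA (σ i) i).const_mul _
  simp only [Matrix.det_apply']
  convert h using 1
  ext v
  have hcol (i : n) : ∑ k, (A x).adjugate i k * A' k i v =
      ∑ σ : Equiv.Perm n, ((σ.sign : ℤ) : ℝ) *
        ((∏ j ∈ univ.erase i, A x (σ j) j) * A' (σ i) i v) := by
    have h₁ : ∑ k, (A x).adjugate i k * A' k i v =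
        ((A x).updateCol i fun k => A' k i v).det := by
      rw [← Matrix.cramer_apply, Matrix.cramer_eq_adjugate_mulVec]
      rfl
    rw [h₁, Matrix.det_apply']
    refine sum_congr rfl fun σ _ => ?_
    rw [← prod_erase_mul univ _ (mem_univ i), Matrix.updateCol_self]
    congr 2
    exact prod_congr rfl fun j hj => Matrix.updateCol_ne (ne_of_mem_erase hj)
  simp only [_root_.sum_apply, _root_.smul_apply, smul_eq_mul, hcol]
  rw [sum_comm]
  simp only [mul_sum]

theorem DifferentiableAt.matrix_det {E n : Type*} [NormedAddCommGroup E] [NormedSpace ℝ E]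
    [Fintype n] [DecidableEq n] {A : E → Matrix n n ℝ} {x : E}
    (hA : ∀ i j, DifferentiableAt ℝ (fun y => A y i j) x) :
    DifferentiableAt ℝ (fun y => (A y).det) x :=
  (hasFDerivAt_det fun i j => (hA i j).hasFDerivAt).differentiableAt

theorem DifferentiableAt.matrix_inv {E n : Type*} [NormedAddCommGroup E] [NormedSpace ℝ E]
    [Fintype n] [DecidableEq n] {A : E → Matrix n n ℝ} {x : E}
    (hA : ∀ i j, DifferentiableAt ℝ (fun y => A y i j) x) (hdet : (A x).det ≠ 0) (i j : n) :
    DifferentiableAt ℝ (fun y => (A y)⁻¹ i j) x := by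
  simp only [Matrix.inv_def, Matrix.smul_apply, smul_eq_mul, Ring.inverse_eq_inv',
    Matrix.adjugate_apply]
  refine ((DifferentiableAt.matrix_det hA).inv hdet).mul (DifferentiableAt.matrix_det ?_)
  intro k l
  by_cases hk : k = j
  · subst hk
    simp
  · simpa [Matrix.updateRow_ne hk] using hA k l

section PartialDerivative

variable {f h : (Fin 4 → ℝ) → ℝ} {x : Fin 4 → ℝ}

theorem pd_congr (i : Fin 4) (hfh : f =ᶠ[nhds x] h) : pd i f x = pd i h x := by
  simp only [pd, hfh.fderiv_eq]

theorem pd_mul (i : Fin 4) (hf : DifferentiableAt ℝ f x) (hh : DifferentiableAt ℝ h x) :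
    pd i (fun y => f y * h y) x = pd i f x * h x + f x * pd i h x := by
  simp only [pd, fderiv_fun_mul hf hh, _root_.add_apply,
    _root_.smul_apply, smul_eq_mul]
  ring

theorem pd_add (i : Fin 4) (hf : DifferentiableAt ℝ f x) (hh : DifferentiableAt ℝ h x) :
    pd i (fun y => f y + h y) x = pd i f x + pd i h x := by
  simp only [pd, fderiv_fun_add hf hh, _root_.add_apply]

theorem pd_sub (i : Fin 4) (hf : DifferentiableAt ℝ f x) (hh : DifferentiableAt ℝ h x) :
    pd i (fun y => f y - h y) x = pd i f x - pd i h x := by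
  simp only [pd, fderiv_fun_sub hf hh, _root_.sub_apply]

theorem pd_const_mul (i : Fin 4) (c : ℝ) (hf : DifferentiableAt ℝ f x) :
    pd i (fun y => c * f y) x = c * pd i f x := by
  simp only [pd, fderiv_const_mul hf, _root_.smul_apply, smul_eq_mul]

theorem pd_sum (i : Fin 4) {ι : Type*} [Fintype ι] {F : ι → (Fin 4 → ℝ) → ℝ}
    (hF : ∀ k, DifferentiableAt ℝ (F k) x) :
    pd i (fun y => ∑ k, F k y) x = ∑ k, pd i (F k) x := by
  simp only [pd, fderiv_fun_sum fun k _ => hF k, _root_.sum_apply]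

theorem differentiableAt_pd (hf : ContDiffAt ℝ 2 f x) (i : Fin 4) :
    DifferentiableAt ℝ (pd i f) x :=
  ((hf.fderiv_right (m := 1) (by norm_num)).differentiableAt one_ne_zero).clm_apply
    (differentiableAt_const _)

theorem pd_comm (hf : ContDiffAt ℝ 2 f x) (i j : Fin 4) :
    pd i (pd j f) x = pd j (pd i f) x := by
  have hd : DifferentiableAt ℝ (fderiv ℝ f) x :=
    (hf.fderiv_right (m := 1) (by norm_num)).differentiableAt one_ne_zero
  have hpd (k l : Fin 4) :
      pd k (pd l f) x = fderiv ℝ (fderiv ℝ f) x (Pi.single k 1) (Pi.single l 1) := by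
    change fderiv ℝ (fun y => fderiv ℝ f y (Pi.single l 1)) x (Pi.single k 1) = _
    rw [fderiv_clm_apply hd (differentiableAt_const _)]
    simp
  rw [hpd, hpd]
  exact hf.isSymmSndFDerivAt (by simp) _ _

end PartialDerivative

/-- The logarithmic derivative of the volume density, in terms of the inverse metric. -/
theorem pd_sqrt_neg_det {g gbar : (Fin 4 → ℝ) → Matrix (Fin 4) (Fin 4) ℝ} {x : Fin 4 → ℝ}
    (hg : ∀ i j, DifferentiableAt ℝ (fun y => g y i j) x) (hdet : (g x).det < 0)
    (hgbar : gbar =ᶠ[nhds x] fun y => (g y)⁻¹) (i : Fin 4) :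
    pd i (fun y => √(-(g y).det)) x =
      √(-(g x).det) * (-(1 / 2) * ∑ α, ∑ β, g x α β * pd i (fun y => gbar y β α) x) := by
  have hne : (g x).det ≠ 0 := hdet.ne
  have hgb (k l : Fin 4) : DifferentiableAt ℝ (fun y => gbar y k l) x :=
    (DifferentiableAt.matrix_inv hg hne k l).congr_of_eventuallyEq
      (hgbar.mono fun y hy => by simp only [hy])
  have hsqrt : √(-(g x).det) * √(-(g x).det) = -(g x).det :=
    Real.mul_self_sqrt (by linarith)
  have hpos : 0 < √(-(g x).det) := Real.sqrt_pos.2 (by linarith)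
  have hd := ((hasFDerivAt_det fun k l => (hg k l).hasFDerivAt).fun_neg.sqrt
    (neg_ne_zero.2 hne)).fderiv
  have hadj (k l : Fin 4) : (g x).adjugate k l = (g x).det * gbar x k l := by
    rw [hgbar.eq_of_nhds, Matrix.inv_def, Matrix.smul_apply, Ring.inverse_eq_inv', smul_eq_mul,
      mul_inv_cancel_left₀ hne]
  have hcancel : ∑ α, ∑ β, (pd i (fun y => g y α β) x * gbar x β α +
      g x α β * pd i (fun y => gbar y β α) x) = 0 := by
    refine sum_eq_zero fun α _ => ?_
    have hone : (fun y => ∑ β, g y α β * gbar y β α) =ᶠ[nhds x] fun _ => 1 := by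
      have hnhds : ∀ᶠ y in nhds x, (g y).det ≠ 0 :=
        (DifferentiableAt.matrix_det hg).continuousAt.eventually_ne hne
      filter_upwards [hnhds, hgbar] with y hy hby
      rw [← Matrix.mul_apply, hby, Matrix.mul_nonsing_inv _ (isUnit_iff_ne_zero.2 hy),
        Matrix.one_apply_eq]
    have hz := pd_congr i hone
    rw [pd_sum i fun β => (hg α β).fun_mul (hgb β α)] at hz
    simp only [pd_mul i (hg α _) (hgb _ α)] at hz
    rw [hz]
    simp [pd]
  simp only [sum_add_distrib] at hcancel
  rw [pd, hd]
  simp only [_root_.smul_apply, _root_.neg_apply,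
    _root_.sum_apply, smul_eq_mul, hadj, mul_assoc, ← mul_sum]
  rw [sum_comm]
  change 1 / (2 * √(-(g x).det)) * -((g x).det *
    ∑ α, ∑ β, gbar x β α * pd i (fun y => g y α β) x) = _
  have hswap : ∑ α, ∑ β, gbar x β α * pd i (fun y => g y α β) x =
      -∑ α, ∑ β, g x α β * pd i (fun y => gbar y β α) x := by
    simp only [mul_comm (gbar x _ _)]
    linarith
  rw [hswap]
  field_simp
  rw [pow_two, hsqrt]
  ring

/-- The pointwise algebra behind the divergence identity: `p` and `H` stand for the first and second
derivatives of the scalar field, `J` for those of the multiplier and `D` for those of the inverse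
metric `G`. -/
theorem divergence_identity_algebra {g G H J : Matrix (Fin 4) (Fin 4) ℝ}
    {D : Fin 4 → Matrix (Fin 4) (Fin 4) ℝ} {p X : Fin 4 → ℝ} (W s : ℝ)
    (hg : g.IsSymm) (hG : G.IsSymm) (hH : H.IsSymm) (hgG : g * G = 1) :
    ∑ α, (∑ β, G α β * p β) * (∑ γ, (J α γ * p γ + X γ * H α γ))
      - ∑ α, (-(1 / 2) * (∑ β, ∑ γ, g β γ * D α γ β) * (X α * W)
        + (J α α * W + X α * (1 / 2 * ∑ γ, ∑ δ, (D α γ δ * p γ * p δ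
          + G γ δ * (H α γ * p δ + p γ * H α δ)) + 2 * s * p α))) =
      1 / 2 * (∑ α, ∑ β, (p α * p β - g α β * W) *
        ∑ γ, (G α γ * J γ β + G β γ * J γ α - X γ * D γ α β))
        - 2 * (∑ γ, X γ * p γ) * s := by
  have hquad : ∑ α, ∑ β, p α * p β * ∑ γ, (G α γ * J γ β + G β γ * J γ α - X γ * D γ α β) =
      2 * (∑ α, (∑ β, G α β * p β) * ∑ γ, J α γ * p γ)
        - ∑ α, X α * ∑ γ, ∑ δ, D α γ δ * p γ * p δ := by
    simp only [Fin.sum_univ_four]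
    rw [hG.apply 0 1, hG.apply 0 2, hG.apply 0 3, hG.apply 1 2, hG.apply 1 3, hG.apply 2 3]
    ring
  have hhess : ∑ α, (∑ β, G α β * p β) * (∑ γ, X γ * H α γ) =
      1 / 2 * ∑ α, X α * ∑ γ, ∑ δ, G γ δ * (H α γ * p δ + p γ * H α δ) := by
    simp only [Fin.sum_univ_four]
    rw [hG.apply 0 1, hG.apply 0 2, hG.apply 0 3, hG.apply 1 2, hG.apply 1 3, hG.apply 2 3,
      hH.apply 0 1, hH.apply 0 2, hH.apply 0 3, hH.apply 1 2, hH.apply 1 3, hH.apply 2 3]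
    ring
  have hJ : ∑ α, ∑ β, g α β * ∑ γ, G β γ * J γ α = ∑ α, J α α := by
    have htr : (g * (G * J)).trace = J.trace := by rw [← Matrix.mul_assoc, hgG, Matrix.one_mul]
    simpa only [Matrix.trace, Matrix.diag_apply, Matrix.mul_apply] using htr
  have hJ' : ∑ α, ∑ β, g α β * ∑ γ, G α γ * J γ β = ∑ α, J α α := by
    rw [sum_comm, ← hJ]
    simp only [hg.apply]
  have htrace : ∑ α, ∑ β, g α β * ∑ γ, (G α γ * J γ β + G β γ * J γ α - X γ * D γ α β) =
      2 * ∑ α, J α α - ∑ α, X α * ∑ β, ∑ γ, g β γ * D α γ β := by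
    have hD : ∑ α, ∑ β, g α β * ∑ γ, X γ * D γ α β =
        ∑ α, X α * ∑ β, ∑ γ, g β γ * D α γ β := by
      simp only [Fin.sum_univ_four]
      rw [hg.apply 0 1, hg.apply 0 2, hg.apply 0 3, hg.apply 1 2, hg.apply 1 3, hg.apply 2 3]
      ring
    simp only [sum_sub_distrib, sum_add_distrib, mul_sub, mul_add, hJ, hJ', hD]
    ring
  have hsplit : ∑ α, ∑ β, (p α * p β - g α β * W) *
        ∑ γ, (G α γ * J γ β + G β γ * J γ α - X γ * D γ α β) =
      ∑ α, ∑ β, p α * p β * ∑ γ, (G α γ * J γ β + G β γ * J γ α - X γ * D γ α β)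
      - W * ∑ α, ∑ β, g α β * ∑ γ, (G α γ * J γ β + G β γ * J γ α - X γ * D γ α β) := by
    simp only [Finset.mul_sum _ _ W, ← sum_sub_distrib]
    exact sum_congr rfl fun α _ => sum_congr rfl fun β _ => by ring
  have hfst : ∑ α, (∑ β, G α β * p β) * (∑ γ, (J α γ * p γ + X γ * H α γ)) =
      ∑ α, (∑ β, G α β * p β) * (∑ γ, J α γ * p γ)
      + ∑ α, (∑ β, G α β * p β) * (∑ γ, X γ * H α γ) := by
    simp only [sum_add_distrib, mul_add]
  have hsnd : ∑ α, (-(1 / 2) * (∑ β, ∑ γ, g β γ * D α γ β) * (X α * W)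
        + (J α α * W + X α * (1 / 2 * ∑ γ, ∑ δ, (D α γ δ * p γ * p δ
          + G γ δ * (H α γ * p δ + p γ * H α δ)) + 2 * s * p α))) =
      -(1 / 2) * W * (∑ α, X α * ∑ β, ∑ γ, g β γ * D α γ β) + W * ∑ α, J α α
      + 1 / 2 * (∑ α, X α * ∑ γ, ∑ δ, D α γ δ * p γ * p δ)
      + 1 / 2 * (∑ α, X α * ∑ γ, ∑ δ, G γ δ * (H α γ * p δ + p γ * H α δ))
      + 2 * s * ∑ α, X α * p α := by
    simp only [Fin.sum_univ_four]
    ring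
  rw [hsplit, hquad, htrace, hfst, hhess, hsnd]
  ring

/-- with Q, π and P as defined, the divergence identity
μ⁻¹ Σ_α ∂_α(μ P^α) = (□_g φ)(Σ_γ X^γ ∂_γφ) + ½ Σ_{α,β} Q_{αβ} π^{αβ} − 2 (Σ_γ X^γ ∂_γφ) φ
holds at every point of U. -/
theorem stmt_15
    (U : Set (Fin 4 → ℝ)) (hU : IsOpen U)
    (g : (Fin 4 → ℝ) → Matrix (Fin 4) (Fin 4) ℝ)
    (hgsymm : ∀ x ∈ U, (g x).IsSymm)
    (hgC1 : ∀ i j : Fin 4, ContDiffOn ℝ 1 (fun x => g x i j) U)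
    (hgdet : ∀ x ∈ U, (g x).det < 0)
    (gbar : (Fin 4 → ℝ) → Matrix (Fin 4) (Fin 4) ℝ)
    (hgbar : ∀ x ∈ U, gbar x = (g x)⁻¹)
    (μ : (Fin 4 → ℝ) → ℝ)
    (hμ : ∀ x, μ x = Real.sqrt (-(g x).det))
    (φ : (Fin 4 → ℝ) → ℝ) (hφ : ContDiffOn ℝ 2 φ U)
    (X : (Fin 4 → ℝ) → Fin 4 → ℝ)
    (hX : ∀ i : Fin 4, ContDiffOn ℝ 1 (fun x => X x i) U)
    (Q : (Fin 4 → ℝ) → Matrix (Fin 4) (Fin 4) ℝ)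
    (hQ : ∀ x, ∀ α β : Fin 4,
      Q x α β = pd α φ x * pd β φ x
        - 1 / 2 * g x α β * (∑ γ : Fin 4, ∑ δ : Fin 4, gbar x γ δ * pd γ φ x * pd δ φ x)
        - g x α β * (φ x) ^ 2)
    (pit : (Fin 4 → ℝ) → Matrix (Fin 4) (Fin 4) ℝ)
    (hpit : ∀ x, ∀ α β : Fin 4,
      pit x α β = ∑ γ : Fin 4,
        (gbar x α γ * pd γ (fun y => X y β) x + gbar x β γ * pd γ (fun y => X y α) x
          - X x γ * pd γ (fun y => gbar y α β) x))
    (P : (Fin 4 → ℝ) → Fin 4 → ℝ)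
    (hP : ∀ x, ∀ α : Fin 4, P x α = ∑ β : Fin 4, ∑ γ : Fin 4, gbar x α β * Q x β γ * X x γ)
    (box : ((Fin 4 → ℝ) → ℝ) → (Fin 4 → ℝ) → ℝ)
    (hbox : ∀ w x, box w x =
      (μ x)⁻¹ * ∑ α : Fin 4, pd α (fun y => μ y * ∑ β : Fin 4, gbar y α β * pd β w y) x) :
    ∀ x ∈ U,
      (μ x)⁻¹ * ∑ α : Fin 4, pd α (fun y => μ y * P y α) x
        = box φ x * (∑ γ : Fin 4, X x γ * pd γ φ x)
          + 1 / 2 * (∑ α : Fin 4, ∑ β : Fin 4, Q x α β * pit x α β)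
          - 2 * (∑ γ : Fin 4, X x γ * pd γ φ x) * φ x := by
  intro x hx
  have hUx : U ∈ nhds x := hU.mem_nhds hx
  have hg (i j : Fin 4) : DifferentiableAt ℝ (fun y => g y i j) x :=
    ((hgC1 i j).contDiffAt hUx).differentiableAt one_ne_zero
  have hne : (g x).det ≠ 0 := (hgdet x hx).ne
  have hgb : gbar =ᶠ[nhds x] fun y => (g y)⁻¹ := Filter.eventually_of_mem hUx hgbar
  have hG (i j : Fin 4) : DifferentiableAt ℝ (fun y => gbar y i j) x :=
    (DifferentiableAt.matrix_inv hg hne i j).congr_of_eventuallyEq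
      (hgb.mono fun y hy => by simp only [hy])
  have hXd (i : Fin 4) : DifferentiableAt ℝ (fun y => X y i) x :=
    ((hX i).contDiffAt hUx).differentiableAt one_ne_zero
  have hφx : ContDiffAt ℝ 2 φ x := hφ.contDiffAt hUx
  have hφd : DifferentiableAt ℝ φ x := hφx.differentiableAt two_ne_zero
  have hp := differentiableAt_pd hφx
  have hμ' : μ = fun y => √(-(g y).det) := funext hμ
  have hμd : DifferentiableAt ℝ μ x := by
    rw [hμ']
    exact (DifferentiableAt.matrix_det hg).fun_neg.sqrt (neg_ne_zero.2 hne)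
  have hμne : μ x ≠ 0 := by
    rw [hμ]
    exact (Real.sqrt_pos.2 (neg_pos.2 (hgdet x hx))).ne'
  have hpdμ (α : Fin 4) : pd α μ x =
      μ x * (-(1 / 2) * ∑ β, ∑ γ, g x β γ * pd α (fun y => gbar y γ β) x) := by
    rw [hμ', pd_sqrt_neg_det hg (hgdet x hx) hgb]
  have hinv (y) (hy : y ∈ U) : gbar y * g y = 1 := by
    rw [hgbar y hy, Matrix.nonsing_inv_mul _ (isUnit_iff_ne_zero.2 (hgdet y hy).ne)]
  set F : (Fin 4 → ℝ) → ℝ := fun y => ∑ γ, X y γ * pd γ φ y with hF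
  set W : (Fin 4 → ℝ) → ℝ := fun y =>
    1 / 2 * (∑ γ, ∑ δ, gbar y γ δ * pd γ φ y * pd δ φ y) + φ y * φ y with hW
  have hFd : DifferentiableAt ℝ F x := by fun_prop
  have hWd : DifferentiableAt ℝ W x := by fun_prop
  have hPW (α : Fin 4) (y) (hy : y ∈ U) :
      P y α = (∑ β, gbar y α β * pd β φ y) * F y - X y α * W y := by
    have hgX : ∑ β, ∑ γ, gbar y α β * g y β γ * X y γ = X y α := by
      have h : (gbar y * g y).mulVec (X y) α = X y α := by rw [hinv y hy, Matrix.one_mulVec]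
      rw [sum_comm]
      simpa only [Matrix.mulVec, dotProduct, Matrix.mul_apply, sum_mul] using h
    rw [hP, ← hgX, hF, sum_mul_sum, sum_mul, ← sum_sub_distrib]
    refine sum_congr rfl fun β _ => ?_
    rw [sum_mul, ← sum_sub_distrib]
    refine sum_congr rfl fun γ _ => ?_
    rw [hQ]
    ring
  have hpdP (α : Fin 4) : pd α (fun y => μ y * P y α) x =
      pd α (fun y => μ y * ∑ β, gbar y α β * pd β φ y) x * F x
      + μ x * ((∑ β, gbar x α β * pd β φ x) * pd α F x)
      - μ x * (-(1 / 2) * (∑ β, ∑ γ, g x β γ * pd α (fun y => gbar y γ β) x) * (X x α * W x)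
        + (pd α (fun y => X y α) x * W x + X x α * pd α W x)) := by
    have hcongr : (fun y => μ y * P y α) =ᶠ[nhds x]
        fun y => (μ y * ∑ β, gbar y α β * pd β φ y) * F y - μ y * (X y α * W y) := by
      filter_upwards [hUx] with y hy
      rw [hPW α y hy]
      ring
    rw [pd_congr α hcongr, pd_sub α (by fun_prop) (by fun_prop),
      pd_mul α (f := fun y => μ y * ∑ β, gbar y α β * pd β φ y) (by fun_prop) hFd,
      pd_mul α (h := fun y => X y α * W y) hμd (by fun_prop), pd_mul α (hXd α) hWd, hpdμ]
    ring
  have hpdF (α : Fin 4) : pd α F x =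
      ∑ γ, (pd α (fun y => X y γ) x * pd γ φ x + X x γ * pd α (pd γ φ) x) := by
    rw [hF, pd_sum α fun γ => (hXd γ).fun_mul (hp γ)]
    exact sum_congr rfl fun γ _ => pd_mul α (hXd γ) (hp γ)
  have hpdW (α : Fin 4) : pd α W x =
      1 / 2 * (∑ γ, ∑ δ, (pd α (fun y => gbar y γ δ) x * pd γ φ x * pd δ φ x
        + gbar x γ δ * (pd α (pd γ φ) x * pd δ φ x + pd γ φ x * pd α (pd δ φ) x)))
      + 2 * φ x * pd α φ x := by
    rw [hW, pd_add α (by fun_prop) (by fun_prop), pd_const_mul α _ (by fun_prop),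
      pd_sum α fun γ => by fun_prop, pd_mul α hφd hφd]
    congr 1
    · congr 1
      refine sum_congr rfl fun γ _ => ?_
      rw [pd_sum α fun δ => by fun_prop]
      refine sum_congr rfl fun δ _ => ?_
      rw [pd_mul α (f := fun y => gbar y γ δ * pd γ φ y) (by fun_prop) (hp δ),
        pd_mul α (hG γ δ) (hp γ)]
      ring
    · ring
  have hQW (α β : Fin 4) : Q x α β = pd α φ x * pd β φ x - g x α β * W x := by
    rw [hQ, hW]
    ring
  have hGsymm : (gbar x).IsSymm := by
    rw [hgbar x hx, Matrix.IsSymm, Matrix.transpose_nonsing_inv, (hgsymm x hx).eq]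
  have key := divergence_identity_algebra (g := g x) (G := gbar x)
    (H := Matrix.of fun α β => pd α (pd β φ) x) (J := Matrix.of fun α β => pd α (fun y => X y β) x)
    (D := fun γ => Matrix.of fun α β => pd γ (fun y => gbar y α β) x)
    (p := fun α => pd α φ x) (X := X x) (W x) (φ x) (hgsymm x hx) hGsymm
    (Matrix.IsSymm.ext fun α β => pd_comm hφx β α) (mul_eq_one_comm.1 (hinv x hx))
  simp only [Matrix.of_apply, ← hpdF, ← hpdW] at key
  have hFx : F x = ∑ γ, X x γ * pd γ φ x := rfl
  simp only [hpit, hQW]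
  rw [add_sub_assoc, ← key, hbox, ← hFx]
  simp only [hpdP]
  rw [sum_sub_distrib, sum_add_distrib, ← sum_mul, ← mul_sum, ← mul_sum, mul_sub, mul_add,
    inv_mul_cancel_left₀ hμne, inv_mul_cancel_left₀ hμne]
  ring
end
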